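/- For all real numbers x, t, s with |x^2 * t * s| < 1, the double series ∑_{m,n≥0} H_{m,n}(x)^2 t^m s^n / (m! n!) converges (as a sum over ℕ × ℕ) and its sum equals (1 - x^2 t s)⁻¹ · exp((t + s + 2 x t s) / (1 - x^2 t s)). -/

import Mathlib

/-- The straight Hermite polynomial
`H_{m,n}(x) = ∑_{k=0}^{min(m,n)} C(m,k) C(n,k) k! x^k`. -/
def straightHermite (m n : ℕ) (x : ℝ) : ℝ :=
  ∑ k ∈ Finset.range (min m n + 1),
    (Nat.choose m k : ℝ) * (Nat.choose n k : ℝ) * (Nat.factorial k : ℝ) * x ^ k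

open Finset in
lemma straightHermite_eq_sum_range {m n N : ℕ} (hN : m < N) (x : ℝ) :
    straightHermite m n x =
      ∑ k ∈ range N, (m.choose k : ℝ) * (n.choose k : ℝ) * (k.factorial : ℝ) * x ^ k := by
  refine sum_subset (range_subset_range.2 (by omega)) fun k _ hk => ?_
  rw [mem_range, not_lt] at hk
  rcases lt_or_ge m k with h | h
  · simp [Nat.choose_eq_zero_of_lt h]
  · simp [Nat.choose_eq_zero_of_lt (show n < k by omega)]

lemma straightHermite_comm (m n : ℕ) (x : ℝ) :
    straightHermite m n x = straightHermite n m x := by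
  simp only [straightHermite, min_comm m n]
  exact Finset.sum_congr rfl fun k _ => by ring

lemma straightHermite_zero_left (n : ℕ) (x : ℝ) : straightHermite 0 n x = 1 := by
  simp [straightHermite]

lemma straightHermite_succ_left (m n : ℕ) (x : ℝ) :
    straightHermite (m + 1) n x =
      straightHermite m n x + x * n * straightHermite m (n - 1) x := by
  rw [straightHermite_eq_sum_range (show m + 1 < m + 2 by omega),
    straightHermite_eq_sum_range (show m < m + 2 by omega),
    straightHermite_eq_sum_range (show m < m + 1 by omega),
    Finset.sum_range_succ', Finset.sum_range_succ' _ (m + 1), Finset.mul_sum,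
    add_right_comm, ← Finset.sum_add_distrib]
  simp only [Nat.choose_zero_right]
  congr 1
  refine Finset.sum_congr rfl fun k _ => ?_
  have key : (n : ℝ) * ((n - 1).choose k : ℝ) = n.choose (k + 1) * (k + 1) := by
    cases n with
    | zero => simp
    | succ n => exact_mod_cast Nat.add_one_mul_choose_eq n k
  rw [Nat.choose_succ_succ, Nat.factorial_succ]
  push_cast
  linear_combination (-(m.choose k : ℝ) * k.factorial * x ^ (k + 1)) * key

lemma straightHermite_succ_right (m n : ℕ) (x : ℝ) :
    straightHermite m (n + 1) x =
      straightHermite m n x + x * m * straightHermite (m - 1) n x := by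
  rw [straightHermite_comm, straightHermite_succ_left, straightHermite_comm n,
    straightHermite_comm n]

/-- A linear recurrence for the squares of the straight Hermite polynomials. -/
lemma straightHermite_succ_left_sq (m n : ℕ) (x : ℝ) :
    straightHermite (m + 1) n x ^ 2 =
      straightHermite m n x ^ 2
        + (2 * x + x ^ 2 + 2 * x ^ 2 * m) * (n * straightHermite m (n - 1) x ^ 2)
        + x ^ 2 * (n * ((n - 1 : ℕ) * straightHermite m (n - 1 - 1) x ^ 2))
        - x ^ 4 * m ^ 2 * (n * ((n - 1 : ℕ) * straightHermite (m - 1) (n - 1 - 1) x ^ 2)) := by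
  rw [straightHermite_succ_left]
  rcases n with _ | _ | n
  · simp
  · have h := straightHermite_succ_right m 0 x
    have h0 (k : ℕ) : straightHermite k 0 x = 1 := by
      rw [straightHermite_comm, straightHermite_zero_left]
    simp only [h0, zero_add, Nat.sub_self, h] at h ⊢
    push_cast
    ring
  · have h1 := straightHermite_succ_right m (n + 1) x
    have h2 := straightHermite_succ_right m n x
    simp only [Nat.add_sub_cancel, h1]
    rcases m with _ | m
    · simp only [straightHermite_zero_left]
      push_cast
      ring
    · have h3 := straightHermite_succ_left m (n + 1) x
      simp only [Nat.add_sub_cancel] at h2 h3 ⊢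
      rw [eq_sub_of_add_eq h3.symm, eq_sub_of_add_eq h2.symm]
      push_cast
      ring

lemma abs_straightHermite_le (m n : ℕ) (x : ℝ) :
    |straightHermite m n x| ≤ straightHermite m n |x| := by
  refine (Finset.abs_sum_le_sum_abs _ _).trans_eq (Finset.sum_congr rfl fun k _ => ?_)
  simp [abs_mul, abs_pow]

/-- The homogenized Laguerre polynomial `m! ∑ₖ C(m,k) p^(m-k) w^k / k!`. -/
noncomputable def laguerreHom (w p : ℝ) (m : ℕ) : ℝ :=
  ∑ k ∈ Finset.range (m + 1),
    (m.factorial : ℝ) * (m.choose k * p ^ (m - k)) * (w ^ k / k.factorial)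

lemma choose_mul_pow_sub_mul_pow (m k j : ℕ) (p : ℝ) :
    (m.choose k * p ^ (m - k)) * p ^ j = m.choose k * p ^ (m + j - k) := by
  rcases lt_or_ge m k with h | h
  · simp [Nat.choose_eq_zero_of_lt h]
  · rw [mul_assoc, ← pow_add, Nat.sub_add_comm h]

lemma laguerreHom_eq_sum_range {m N : ℕ} (hN : m < N) (w p : ℝ) :
    laguerreHom w p m = ∑ k ∈ Finset.range N,
      (m.factorial : ℝ) * (m.choose k * p ^ (m - k)) * (w ^ k / k.factorial) := by
  refine Finset.sum_subset (Finset.range_subset_range.2 (by omega)) fun k _ hk => ?_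
  rw [Finset.mem_range, not_lt] at hk
  simp [Nat.choose_eq_zero_of_lt (show m < k by omega)]

lemma laguerreHom_succ (w p : ℝ) (m : ℕ) :
    laguerreHom w p (m + 1) =
      (w + (2 * m + 1) * p) * laguerreHom w p m - m ^ 2 * p ^ 2 * laguerreHom w p (m - 1) := by
  rcases m with _ | m
  · simp [laguerreHom, Finset.sum_range_succ]
    ring
  have hw : w * laguerreHom w p (m + 1) = ∑ k ∈ Finset.range (m + 2),
      ((m + 1).factorial : ℝ) * ((m + 1).choose k * p ^ (m + 1 - k)) *
        (w ^ (k + 1) / k.factorial) := by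
    rw [laguerreHom, Finset.mul_sum]
    exact Finset.sum_congr rfl fun k _ => by ring
  rw [add_mul, hw, laguerreHom_eq_sum_range (show m + 1 < m + 3 by omega), Nat.add_sub_cancel,
    laguerreHom_eq_sum_range (show m < m + 3 by omega), laguerreHom, Finset.sum_range_succ',
    Finset.sum_range_succ' _ (m + 2), Finset.sum_range_succ' _ (m + 2), mul_add, mul_add,
    Finset.mul_sum, Finset.mul_sum]
  rw [show ∀ a b c d e : ℝ, a + (b + c) - (d + e) = (a + b - d) + (c - e) by intros; ring,
    ← Finset.sum_add_distrib, ← Finset.sum_sub_distrib]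
  congr 1
  · refine Finset.sum_congr rfl fun k _ => ?_
    have e1 := choose_mul_pow_sub_mul_pow (m + 1) (k + 1) 1 p
    have e2 := choose_mul_pow_sub_mul_pow m (k + 1) 2 p
    simp only [Nat.add_sub_add_right, show m + 2 - (k + 1) = m + 1 - k by omega] at e1 e2 ⊢
    have c1 : ((m : ℝ) + 1) * m.choose k = (m + 1).choose (k + 1) * (k + 1) := by
      exact_mod_cast Nat.add_one_mul_choose_eq m k
    have c2 : ((m : ℝ) + 1 + 1) * (m + 1).choose k = (m + 1 + 1).choose (k + 1) * (k + 1) := by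
      exact_mod_cast Nat.add_one_mul_choose_eq (m + 1) k
    have c3 : ((m + 1 + 1).choose (k + 1) : ℝ) = (m + 1).choose k + (m + 1).choose (k + 1) := by
      exact_mod_cast Nat.choose_succ_succ (m + 1) k
    have c4 : ((m + 1).choose (k + 1) : ℝ) = m.choose k + m.choose (k + 1) := by
      exact_mod_cast Nat.choose_succ_succ m k
    have hc : ((m : ℝ) + 2) * (m + 1 + 1).choose (k + 1) =
        (k + 1) * (m + 1).choose k + (2 * m + 3) * (m + 1).choose (k + 1)
          - (m + 1) * m.choose (k + 1) := by
      linear_combination c2 - c1 + (m + 2 + (k + 1)) * c3 - (m + 1) * c4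
    have hk : w ^ (k + 1) / (k.factorial : ℝ) = (k + 1) * (w ^ (k + 1) / (k + 1).factorial) := by
      rw [Nat.factorial_succ]
      push_cast
      field_simp
    rw [hk, Nat.factorial_succ (m + 1), Nat.factorial_succ m]
    generalize w ^ (k + 1) / ((k + 1).factorial : ℝ) = W
    push_cast
    linear_combination ((m + 1) * m.factorial * W) * (p ^ (m + 1 - k) * hc
      - (2 * m + 3) * e1 + (m + 1) * e2)
  · simp only [Nat.factorial_succ, Nat.choose_zero_right, Nat.sub_zero]
    push_cast
    ring

/-- The generating function of the Laguerre polynomials. -/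
lemma hasSum_laguerreHom (w p t : ℝ) (h : |p * t| < 1) :
    HasSum (fun m : ℕ => laguerreHom w p m * t ^ m / m.factorial)
      ((1 - p * t)⁻¹ * Real.exp (w * t / (1 - p * t))) := by
  have row (q v : ℝ) (hq : |q| < 1) (k : ℕ) :
      HasSum (fun j : ℕ => v ^ k / k.factorial * ((j + k).choose k * q ^ j))
        ((1 - q)⁻¹ * ((v / (1 - q)) ^ k / k.factorial)) := by
    have := (hasSum_choose_mul_geometric_of_norm_lt_one k
      (show ‖q‖ < 1 from hq)).mul_left (v ^ k / k.factorial)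
    convert! this using 1
    rw [div_pow, pow_succ]
    field_simp
  have col (q v : ℝ) : HasSum (fun k : ℕ => (1 - q)⁻¹ * ((v / (1 - q)) ^ k / k.factorial))
      ((1 - q)⁻¹ * Real.exp (v / (1 - q))) := by
    rw [Real.exp_eq_exp_ℝ]
    exact (NormedSpace.expSeries_div_hasSum_exp (v / (1 - q))).mul_left _
  set f : ℕ × ℕ → ℝ := fun z =>
    (w * t) ^ z.1 / z.1.factorial * ((z.2 + z.1).choose z.1 * (p * t) ^ z.2) with hf
  have hsum : Summable f := by
    refine Summable.of_norm ?_
    have hnorm : (fun z => ‖f z‖) = fun z : ℕ × ℕ =>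
        |w * t| ^ z.1 / z.1.factorial * ((z.2 + z.1).choose z.1 * |p * t| ^ z.2) := by
      funext z
      simp only [hf, Real.norm_eq_abs, abs_mul, abs_div, abs_pow, Nat.abs_cast]
    have h' : |(|p * t|)| < 1 := by rwa [abs_abs]
    rw [hnorm, summable_prod_of_nonneg fun z => by positivity]
    refine ⟨fun k => (row _ _ h' k).summable, ?_⟩
    simp only [(row _ _ h' _).tsum_eq]
    exact (col _ _).summable
  have hF : HasSum f ((1 - p * t)⁻¹ * Real.exp (w * t / (1 - p * t))) := by
    have := hsum.hasSum.prod_fiberwise fun k => row _ _ h k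
    rw [(col _ _).unique this]
    exact hsum.hasSum
  have hanti := (Finset.HasAntidiagonal.sigmaAntidiagonalEquivProd.hasSum_iff.2 hF).sigma
    fun m => hasSum_fintype _
  convert! hanti using 1
  funext m
  refine Eq.trans ?_ (Finset.sum_coe_sort (Finset.HasAntidiagonal.antidiagonal m) f).symm
  rw [Finset.Nat.sum_antidiagonal_eq_sum_range_succ_mk, laguerreHom, Finset.sum_mul, Finset.sum_div]
  refine Finset.sum_congr rfl fun k hk => ?_
  have hkm : m - k + k = m := Nat.sub_add_cancel (Finset.mem_range_succ_iff.1 hk)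
  have ht : t ^ m = t ^ (m - k) * t ^ k := by rw [← pow_add, hkm]
  simp only [hf, hkm, mul_pow, ht]
  field_simp

lemma HasSum.exponential_shift {g : ℕ → ℝ} {s S : ℝ}
    (hg : HasSum (fun n : ℕ => g n * s ^ n / n.factorial) S) :
    HasSum (fun n : ℕ => n * g (n - 1) * s ^ n / n.factorial) (s * S) := by
  rw [← hasSum_nat_add_iff' 1]
  convert! hg.mul_left s using 1
  · funext n
    rw [Nat.factorial_succ, Nat.add_sub_cancel]
    push_cast
    field_simp
    ring
  · simp

lemma hasSum_straightHermite_sq (x s : ℝ) (m : ℕ) :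
    HasSum (fun n : ℕ => straightHermite m n x ^ 2 * s ^ n / n.factorial)
      (Real.exp s * laguerreHom ((1 + x * s) ^ 2) (x ^ 2 * s) m) := by
  induction m using Nat.strong_induction_on with
  | _ m ih =>
    rcases m with _ | m
    · simp only [straightHermite_zero_left, one_pow, one_mul, laguerreHom]
      simpa [Real.exp_eq_exp_ℝ] using NormedSpace.expSeries_div_hasSum_exp s
    · have h0 := ih m (by omega)
      have h1 := ih (m - 1) (by omega)
      have := ((h0.add (h0.exponential_shift.mul_left (2 * x + x ^ 2 + 2 * x ^ 2 * m))).add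
        (HasSum.exponential_shift
          (g := fun n => n * straightHermite m (n - 1) x ^ 2)
          h0.exponential_shift |>.mul_left (x ^ 2))).sub
        (HasSum.exponential_shift
          (g := fun n => n * straightHermite (m - 1) (n - 1) x ^ 2)
          h1.exponential_shift |>.mul_left (x ^ 4 * m ^ 2))
      convert! this using 1
      · funext n
        rw [straightHermite_succ_left_sq]
        ring
      · rw [laguerreHom_succ]
        ring

/-- The heterosexual Mehler formula specialized at `y = x`. -/
theorem heterosexual_mehler_diag (x t s : ℝ) (h : |x ^ 2 * t * s| < 1) :
    HasSum
      (fun p : ℕ × ℕ =>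
        straightHermite p.1 p.2 x ^ 2 * t ^ p.1 * s ^ p.2 /
          ((Nat.factorial p.1 : ℝ) * (Nat.factorial p.2 : ℝ)))
      ((1 - x ^ 2 * t * s)⁻¹ *
        Real.exp ((t + s + 2 * x * t * s) / (1 - x ^ 2 * t * s))) := by
  have row (x t s : ℝ) (m : ℕ) :
      HasSum (fun n : ℕ => straightHermite m n x ^ 2 * t ^ m * s ^ n / (m.factorial * n.factorial))
        (Real.exp s * (laguerreHom ((1 + x * s) ^ 2) (x ^ 2 * s) m * t ^ m / m.factorial)) := by
    convert! (hasSum_straightHermite_sq x s m).mul_left (t ^ m / m.factorial) using 1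
    · funext n
      field_simp
    · ring
  have col (x t s : ℝ) (h : |x ^ 2 * t * s| < 1) :=
    (hasSum_laguerreHom ((1 + x * s) ^ 2) (x ^ 2 * s) t
      (by rwa [mul_right_comm])).mul_left (Real.exp s)
  have hsum : Summable fun p : ℕ × ℕ =>
      straightHermite p.1 p.2 x ^ 2 * t ^ p.1 * s ^ p.2 / (p.1.factorial * p.2.factorial) := by
    have habs : |(|x| ^ 2 * |t| * |s|)| < 1 := by simpa [abs_mul] using h
    refine Summable.of_norm_bounded (g := fun p : ℕ × ℕ =>
      straightHermite p.1 p.2 |x| ^ 2 * |t| ^ p.1 * |s| ^ p.2 /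
        (p.1.factorial * p.2.factorial)) ?_ fun p => ?_
    · rw [summable_prod_of_nonneg fun p => by positivity]
      refine ⟨fun m => (row |x| |t| |s| m).summable, ?_⟩
      simp only [(row |x| |t| |s| _).tsum_eq]
      exact (col _ _ _ habs).summable
    · simp only [Real.norm_eq_abs, abs_div, abs_mul, abs_pow, Nat.abs_cast]
      gcongr
      exact abs_straightHermite_le _ _ _
  have hiter := (hsum.hasSum.prod_fiberwise fun m => row x t s m).unique (col x t s h)
  convert! hsum.hasSum using 1
  rw [hiter, mul_left_comm, ← Real.exp_add, mul_right_comm (x ^ 2)]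
  have hne : 1 - x ^ 2 * s * t ≠ 0 := by
    have := (abs_lt.1 h).2
    rw [mul_right_comm]
    linarith
  congr 2
  rw [add_div' _ _ _ hne]
  congr 1
  ring
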